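/- For every set S ⊆ ℕ of positive integers, the Hausdorff dimension of X(S) equals the lower density of S, i.e. dim_H X(S) = liminf_{N→∞} |S ∩ [1,N]|/N. -/

import Mathlib

open Filter Set

/-- `XS S` is the set of reals in `[0,1]` admitting a binary expansion
`x = ∑ ξ_n 2^{-n}` (digits `ξ_n ∈ {0,1}`, indexed by `n ≥ 1`) with `ξ_n = 0`
for every `n ∉ S`. -/
def XS (S : Set ℕ) : Set ℝ :=
  {x | ∃ ξ : ℕ → ℕ, (∀ n, ξ n ≤ 1) ∧ (∀ n, 1 ≤ n → n ∉ S → ξ n = 0) ∧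
    x = ∑' n : ℕ, (ξ (n + 1) : ℝ) / 2 ^ (n + 1)}

open scoped Classical in
/-- `prefixCount S N` is the number of elements of `S` in `[1, N]`. -/
noncomputable def prefixCount (S : Set ℕ) (N : ℕ) : ℕ :=
  Nat.count (fun n => n + 1 ∈ S) N

open scoped Classical in
/-- The integer whose binary digits are the `ξ n` with `n ∈ S ∩ [1, N]`, in order. -/
noncomputable def prefixVal (S : Set ℕ) (ξ : ℕ → ℕ) : ℕ → ℕ
  | 0 => 0
  | N + 1 => if N + 1 ∈ S then 2 * prefixVal S ξ N + ξ (N + 1) else prefixVal S ξ N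

/-- The real number whose binary digits are the `ξ n` with `n ∈ S`, in order. -/
noncomputable def compress (S : Set ℕ) (ξ : ℕ → ℕ) : ℝ :=
  ⨆ N, (prefixVal S ξ N : ℝ) / 2 ^ prefixCount S N

lemma prefixCount_zero (S : Set ℕ) : prefixCount S 0 = 0 := by
  simp [prefixCount]

lemma prefixCount_succ_of_mem {S : Set ℕ} {N : ℕ} (h : N + 1 ∈ S) :
    prefixCount S (N + 1) = prefixCount S N + 1 := by
  simp [prefixCount, Nat.count_succ, h]

lemma prefixCount_succ_of_notMem {S : Set ℕ} {N : ℕ} (h : N + 1 ∉ S) :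
    prefixCount S (N + 1) = prefixCount S N := by
  simp [prefixCount, Nat.count_succ, h]

lemma prefixVal_succ_of_mem {S : Set ℕ} (ξ : ℕ → ℕ) {N : ℕ} (h : N + 1 ∈ S) :
    prefixVal S ξ (N + 1) = 2 * prefixVal S ξ N + ξ (N + 1) := by
  simp [prefixVal, h]

lemma prefixVal_succ_of_notMem {S : Set ℕ} (ξ : ℕ → ℕ) {N : ℕ} (h : N + 1 ∉ S) :
    prefixVal S ξ (N + 1) = prefixVal S ξ N := by
  simp [prefixVal, h]

lemma prefixCount_univ (N : ℕ) : prefixCount univ N = N := by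
  induction N with
  | zero => exact prefixCount_zero _
  | succ N ih => rw [prefixCount_succ_of_mem (mem_univ _), ih]

lemma card_inter_Icc (S : Set ℕ) (N : ℕ) :
    Nat.card ↥(S ∩ Set.Icc 1 N) = prefixCount S N := by
  rw [Nat.card_coe_set_eq]
  induction N with
  | zero => simp [prefixCount_zero]
  | succ N ih =>
    by_cases h : N + 1 ∈ S
    · have : S ∩ Set.Icc 1 (N + 1) = insert (N + 1) (S ∩ Set.Icc 1 N) := by
        ext n
        simp only [mem_inter_iff, mem_Icc, mem_insert_iff]
        constructor
        · rintro ⟨h1, h2, h3⟩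
          by_cases h4 : n = N + 1
          · exact Or.inl h4
          · exact Or.inr ⟨h1, h2, by omega⟩
        · rintro (rfl | ⟨h1, h2, h3⟩)
          · exact ⟨h, by omega, le_rfl⟩
          · exact ⟨h1, h2, by omega⟩
      rw [this, ncard_insert_of_notMem (by simp) ((finite_Icc 1 N).inter_of_right S), ih,
        prefixCount_succ_of_mem h]
    · have : S ∩ Set.Icc 1 (N + 1) = S ∩ Set.Icc 1 N := by
        ext n
        simp only [mem_inter_iff, mem_Icc]
        constructor
        · rintro ⟨h1, h2, h3⟩
          have : n ≠ N + 1 := fun e => h (e ▸ h1)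
          exact ⟨h1, h2, by omega⟩
        · rintro ⟨h1, h2, h3⟩
          exact ⟨h1, h2, by omega⟩
      rw [this, ih, prefixCount_succ_of_notMem h]

lemma prefixCount_le (S : Set ℕ) (N : ℕ) : prefixCount S N ≤ N :=
  open scoped Classical in Nat.count_le _

lemma monotone_prefixVal_div (S : Set ℕ) (ξ : ℕ → ℕ) :
    Monotone fun N => (prefixVal S ξ N : ℝ) / 2 ^ prefixCount S N := by
  refine monotone_nat_of_le_succ fun N => ?_
  by_cases h : N + 1 ∈ S
  · rw [prefixVal_succ_of_mem ξ h, prefixCount_succ_of_mem h, pow_succ,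
      div_le_div_iff₀ (by positivity) (by positivity)]
    push_cast
    have : (0 : ℝ) ≤ ξ (N + 1) * 2 ^ prefixCount S N := by positivity
    nlinarith
  · rw [prefixVal_succ_of_notMem ξ h, prefixCount_succ_of_notMem h]

lemma antitone_prefixVal_succ_div (S : Set ℕ) {ξ : ℕ → ℕ} (hξ : ∀ n, ξ n ≤ 1) :
    Antitone fun N => ((prefixVal S ξ N : ℝ) + 1) / 2 ^ prefixCount S N := by
  refine antitone_nat_of_succ_le fun N => ?_
  by_cases h : N + 1 ∈ S
  · rw [prefixVal_succ_of_mem ξ h, prefixCount_succ_of_mem h, pow_succ,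
      div_le_div_iff₀ (by positivity) (by positivity)]
    push_cast
    have h1 : (ξ (N + 1) : ℝ) ≤ 1 := by exact_mod_cast hξ (N + 1)
    have h2 : (ξ (N + 1) : ℝ) * 2 ^ prefixCount S N ≤ 1 * 2 ^ prefixCount S N := by gcongr
    nlinarith
  · rw [prefixVal_succ_of_notMem ξ h, prefixCount_succ_of_notMem h]

lemma prefixVal_div_le_prefixVal_succ_div (S : Set ℕ) {ξ : ℕ → ℕ} (hξ : ∀ n, ξ n ≤ 1)
    (M N : ℕ) :
    (prefixVal S ξ M : ℝ) / 2 ^ prefixCount S M ≤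
      ((prefixVal S ξ N : ℝ) + 1) / 2 ^ prefixCount S N := by
  calc (prefixVal S ξ M : ℝ) / 2 ^ prefixCount S M
      ≤ (prefixVal S ξ (max M N) : ℝ) / 2 ^ prefixCount S (max M N) :=
        monotone_prefixVal_div S ξ (le_max_left M N)
    _ ≤ ((prefixVal S ξ (max M N) : ℝ) + 1) / 2 ^ prefixCount S (max M N) := by
        gcongr; linarith
    _ ≤ _ := antitone_prefixVal_succ_div S hξ (le_max_right M N)

lemma bddAbove_prefixVal_div (S : Set ℕ) {ξ : ℕ → ℕ} (hξ : ∀ n, ξ n ≤ 1) :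
    BddAbove (range fun N => (prefixVal S ξ N : ℝ) / 2 ^ prefixCount S N) :=
  ⟨_, by rintro _ ⟨M, rfl⟩; exact prefixVal_div_le_prefixVal_succ_div S hξ M 0⟩

lemma prefixVal_div_le_compress (S : Set ℕ) {ξ : ℕ → ℕ} (hξ : ∀ n, ξ n ≤ 1) (N : ℕ) :
    (prefixVal S ξ N : ℝ) / 2 ^ prefixCount S N ≤ compress S ξ :=
  le_ciSup (bddAbove_prefixVal_div S hξ) N

lemma compress_le_prefixVal_succ_div (S : Set ℕ) {ξ : ℕ → ℕ} (hξ : ∀ n, ξ n ≤ 1) (N : ℕ) :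
    compress S ξ ≤ ((prefixVal S ξ N : ℝ) + 1) / 2 ^ prefixCount S N :=
  ciSup_le fun M => prefixVal_div_le_prefixVal_succ_div S hξ M N

/-- With all positions kept, `compress` is the usual value of a binary expansion. -/
lemma tsum_eq_compress_univ {ξ : ℕ → ℕ} (hξ : ∀ n, ξ n ≤ 1) :
    ∑' n : ℕ, (ξ (n + 1) : ℝ) / 2 ^ (n + 1) = compress univ ξ := by
  have hsum : ∀ N, ∑ n ∈ Finset.range N, (ξ (n + 1) : ℝ) / 2 ^ (n + 1) =
      (prefixVal univ ξ N : ℝ) / 2 ^ prefixCount univ N := by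
    intro N
    induction N with
    | zero => simp [prefixVal]
    | succ N ih =>
      rw [Finset.sum_range_succ, ih, prefixCount_univ, prefixCount_univ,
        prefixVal_succ_of_mem ξ (mem_univ _), pow_succ]
      push_cast
      field_simp
  refine HasSum.tsum_eq ?_
  rw [hasSum_iff_tendsto_nat_of_nonneg fun n => by positivity]
  simp only [hsum]
  exact tendsto_atTop_ciSup (monotone_prefixVal_div univ ξ) (bddAbove_prefixVal_div univ hξ)

/-- For digit sequences supported on `S`, prefixes that are equal or adjacent as integers stay
so after deleting the positions outside `S`. -/
lemma prefixVal_sub_eq {S : Set ℕ} {ξ η : ℕ → ℕ} (hξ : ∀ n, ξ n ≤ 1) (hη : ∀ n, η n ≤ 1)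
    (hξS : ∀ n, 1 ≤ n → n ∉ S → ξ n = 0) (hηS : ∀ n, 1 ≤ n → n ∉ S → η n = 0) (N : ℕ)
    (h : |(prefixVal univ ξ N : ℤ) - prefixVal univ η N| ≤ 1) :
    (prefixVal S ξ N : ℤ) - prefixVal S η N =
      (prefixVal univ ξ N : ℤ) - prefixVal univ η N := by
  induction N with
  | zero => simp [prefixVal]
  | succ N ih =>
    rw [abs_le] at h ih
    have h1 := hξ (N + 1)
    have h2 := hη (N + 1)
    rw [prefixVal_succ_of_mem ξ (mem_univ _), prefixVal_succ_of_mem η (mem_univ _)] at h ⊢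
    by_cases hN : N + 1 ∈ S
    · rw [prefixVal_succ_of_mem ξ hN, prefixVal_succ_of_mem η hN]
      push_cast at h ⊢
      have := ih ⟨by omega, by omega⟩
      omega
    · have h3 := hξS _ (by omega) hN
      have h4 := hηS _ (by omega) hN
      rw [prefixVal_succ_of_notMem ξ hN, prefixVal_succ_of_notMem η hN]
      push_cast at h ⊢
      have := ih ⟨by omega, by omega⟩
      omega

lemma abs_compress_sub_le {S : Set ℕ} {ξ η : ℕ → ℕ} (hξ : ∀ n, ξ n ≤ 1) (hη : ∀ n, η n ≤ 1)
    (hξS : ∀ n, 1 ≤ n → n ∉ S → ξ n = 0) (hηS : ∀ n, 1 ≤ n → n ∉ S → η n = 0) (N : ℕ)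
    (h : |compress univ ξ - compress univ η| < (1 / 2) ^ N) :
    |compress S ξ - compress S η| ≤ 2 / 2 ^ prefixCount S N := by
  have h1 := prefixVal_div_le_compress univ hξ N
  have h2 := compress_le_prefixVal_succ_div univ hξ N
  have h3 := prefixVal_div_le_compress univ hη N
  have h4 := compress_le_prefixVal_succ_div univ hη N
  rw [prefixCount_univ] at h1 h2 h3 h4
  have hp : (0 : ℝ) < 2 ^ N := by positivity
  rw [abs_lt, one_div, inv_pow, ← one_div] at h
  have hD : |(prefixVal univ ξ N : ℤ) - prefixVal univ η N| ≤ 1 := by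
    have e1 : ((prefixVal univ ξ N : ℝ)) / 2 ^ N < ((prefixVal univ η N : ℝ) + 2) / 2 ^ N := by
      have : ((prefixVal univ η N : ℝ) + 2) / 2 ^ N =
        ((prefixVal univ η N : ℝ) + 1) / 2 ^ N + 1 / 2 ^ N := by ring
      linarith
    have e2 : ((prefixVal univ η N : ℝ)) / 2 ^ N < ((prefixVal univ ξ N : ℝ) + 2) / 2 ^ N := by
      have : ((prefixVal univ ξ N : ℝ) + 2) / 2 ^ N =
        ((prefixVal univ ξ N : ℝ) + 1) / 2 ^ N + 1 / 2 ^ N := by ring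
      linarith
    rw [div_lt_div_iff_of_pos_right hp] at e1 e2
    norm_cast at e1 e2
    rw [abs_le]
    omega
  have hE := prefixVal_sub_eq hξ hη hξS hηS N hD
  rw [← hE, abs_le] at hD
  have g1 := prefixVal_div_le_compress S hξ N
  have g2 := compress_le_prefixVal_succ_div S hξ N
  have g3 := prefixVal_div_le_compress S hη N
  have g4 := compress_le_prefixVal_succ_div S hη N
  have hD1 : (prefixVal S ξ N : ℝ) ≤ prefixVal S η N + 1 := by
    have : prefixVal S ξ N ≤ prefixVal S η N + 1 := by omega
    exact_mod_cast this
  have hD2 : (prefixVal S η N : ℝ) ≤ prefixVal S ξ N + 1 := by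
    have : prefixVal S η N ≤ prefixVal S ξ N + 1 := by omega
    exact_mod_cast this
  set q : ℝ := 2 ^ prefixCount S N
  have hq : 0 < q := by positivity
  rw [div_le_iff₀ hq] at g1 g3
  rw [le_div_iff₀ hq] at g2 g4
  rw [abs_le, ← neg_div, div_le_iff₀ hq, le_div_iff₀ hq]
  constructor <;> linarith

/-- Every real in `[0, 1)` is the compression of a digit sequence supported on `S`, provided the
counting function of `S` is unbounded. -/
lemma exists_compress_eq {S : Set ℕ} (hS : Tendsto (prefixCount S) atTop atTop) {y : ℝ}
    (hy : y ∈ Ico (0 : ℝ) 1) :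
    ∃ ξ : ℕ → ℕ, (∀ n, ξ n ≤ 1) ∧ (∀ n, 1 ≤ n → n ∉ S → ξ n = 0) ∧ compress S ξ = y := by
  classical
  obtain ⟨hy0, hy1⟩ := hy
  let ξ : ℕ → ℕ := fun n => if n ∈ S then ⌊2 ^ prefixCount S n * y⌋₊ % 2 else 0
  have hξ : ∀ n, ξ n ≤ 1 := by
    intro n
    simp only [ξ]
    split_ifs <;> omega
  have hval : ∀ N, prefixVal S ξ N = ⌊2 ^ prefixCount S N * y⌋₊ := by
    intro N
    induction N with
    | zero =>
      rw [prefixCount_zero, pow_zero, one_mul, Nat.floor_eq_zero.2 hy1]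
      rfl
    | succ N ih =>
      by_cases h : N + 1 ∈ S
      · rw [prefixVal_succ_of_mem ξ h, ih]
        have hdiv : ⌊2 ^ prefixCount S (N + 1) * y / 2⌋₊ =
            ⌊2 ^ prefixCount S (N + 1) * y⌋₊ / 2 := Nat.floor_div_ofNat _ 2
        have : 2 ^ prefixCount S (N + 1) * y / 2 = 2 ^ prefixCount S N * y := by
          rw [prefixCount_succ_of_mem h, pow_succ]; ring
        rw [this] at hdiv
        simp only [ξ, h, if_true]
        omega
      · rw [prefixVal_succ_of_notMem ξ h, ih, prefixCount_succ_of_notMem h]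
  refine ⟨ξ, hξ, fun n _ hn => by simp [ξ, hn], ?_⟩
  have hclose : ∀ N, |compress S ξ - y| ≤ (1 / 2) ^ prefixCount S N := by
    intro N
    have g1 := prefixVal_div_le_compress S hξ N
    have g2 := compress_le_prefixVal_succ_div S hξ N
    have hq : (0 : ℝ) < 2 ^ prefixCount S N := by positivity
    have f1 := Nat.floor_le (mul_nonneg hq.le hy0)
    have f2 := Nat.lt_floor_add_one (2 ^ prefixCount S N * y)
    rw [hval] at g1 g2
    rw [div_le_iff₀ hq] at g1
    rw [le_div_iff₀ hq] at g2
    rw [one_div, inv_pow, ← one_div, abs_le, ← neg_div, div_le_iff₀ hq, le_div_iff₀ hq]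
    constructor <;> nlinarith
  have hlim : Tendsto (fun N => (1 / 2 : ℝ) ^ prefixCount S N) atTop (nhds 0) :=
    (tendsto_pow_atTop_nhds_zero_of_lt_one (by norm_num) (by norm_num)).comp hS
  have := ge_of_tendsto' hlim hclose
  exact sub_eq_zero.1 (abs_eq_zero.1 (le_antisymm this (abs_nonneg _)))

lemma tendsto_prefixCount {S : Set ℕ} {d c : ℝ} (hd : 0 < d)
    (h : ∀ N : ℕ, d * N ≤ prefixCount S N + c) : Tendsto (prefixCount S) atTop atTop := by
  refine (tendsto_natCast_atTop_iff (R := ℝ)).1 ?_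
  have h1 : Tendsto (fun N : ℕ => d * (N : ℝ) + -c) atTop atTop :=
    tendsto_atTop_add_const_right _ _ (tendsto_natCast_atTop_atTop.const_mul_atTop hd)
  exact tendsto_atTop_mono (fun N => by linarith [h N]) h1

lemma abs_compress_sub_le_rpow {S : Set ℕ} {d c : ℝ} (hd : 0 < d) (hc : 0 ≤ c)
    (h : ∀ N : ℕ, d * N ≤ prefixCount S N + c) {ξ η : ℕ → ℕ} (hξ : ∀ n, ξ n ≤ 1)
    (hη : ∀ n, η n ≤ 1) (hξS : ∀ n, 1 ≤ n → n ∉ S → ξ n = 0)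
    (hηS : ∀ n, 1 ≤ n → n ∉ S → η n = 0) :
    |compress S ξ - compress S η| ≤
      2 ^ (1 + c + d) * |compress univ ξ - compress univ η| ^ d := by
  set δ := |compress univ ξ - compress univ η| with hδ
  rcases (abs_nonneg (compress univ ξ - compress univ η)).eq_or_lt with h0 | h0
  · rw [← hδ] at h0
    rw [← h0, Real.zero_rpow hd.ne', mul_zero]
    have hlim : Tendsto (fun N => (2 : ℝ) / 2 ^ prefixCount S N) atTop (nhds 0) :=
      tendsto_const_nhds.div_atTop
        ((tendsto_pow_atTop_atTop_of_one_lt one_lt_two).comp (tendsto_prefixCount hd h))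
    refine ge_of_tendsto' hlim fun N => abs_compress_sub_le hξ hη hξS hηS N ?_
    rw [← hδ, ← h0]
    positivity
  rw [← hδ] at h0
  rcases lt_or_ge δ 1 with h1 | h1
  · obtain ⟨N, hN1, hN2⟩ : ∃ N : ℕ, (1 / 2 : ℝ) ^ (N + 1) ≤ δ ∧ δ < (1 / 2) ^ N := by
      have hex : ∃ n : ℕ, (1 / 2 : ℝ) ^ n ≤ δ :=
        (exists_pow_lt_of_lt_one h0 (by norm_num)).imp fun _ => le_of_lt
      classical
      have hpos : Nat.find hex ≠ 0 := by
        intro e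
        have := Nat.find_spec hex
        rw [e, pow_zero] at this
        linarith
      obtain ⟨N, hN⟩ := Nat.exists_eq_succ_of_ne_zero hpos
      refine ⟨N, ?_, ?_⟩
      · have := Nat.find_spec hex
        rwa [hN] at this
      · exact not_le.1 (Nat.find_min hex (by omega))
    calc |compress S ξ - compress S η| ≤ 2 / 2 ^ prefixCount S N :=
          abs_compress_sub_le hξ hη hξS hηS N hN2
      _ = 2 ^ (1 - (prefixCount S N : ℝ)) := by
          rw [Real.rpow_sub two_pos, Real.rpow_one, Real.rpow_natCast]
      _ ≤ 2 ^ ((1 + c + d) - ((N : ℝ) + 1) * d) :=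
          Real.rpow_le_rpow_of_exponent_le one_le_two (by linarith [h N])
      _ = 2 ^ (1 + c + d) * ((1 / 2 : ℝ) ^ (N + 1)) ^ d := by
          rw [Real.rpow_sub two_pos, one_div, inv_pow, Real.inv_rpow (by positivity),
            Real.rpow_mul two_pos.le, ← Real.rpow_natCast, div_eq_mul_inv]
          push_cast
          rfl
      _ ≤ 2 ^ (1 + c + d) * δ ^ d := by gcongr
  · have hle : |compress S ξ - compress S η| ≤ 1 := by
      have g1 := prefixVal_div_le_compress S hξ 0
      have g2 := compress_le_prefixVal_succ_div S hξ 0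
      have g3 := prefixVal_div_le_compress S hη 0
      have g4 := compress_le_prefixVal_succ_div S hη 0
      simp only [prefixVal, prefixCount_zero, pow_zero, div_one, Nat.cast_zero, zero_add]
        at g1 g2 g3 g4
      rw [abs_le]
      constructor <;> linarith
    have e1 : (1 : ℝ) ≤ 2 ^ (1 + c + d) := Real.one_le_rpow one_le_two (by linarith)
    have e2 : (1 : ℝ) ≤ δ ^ d := Real.one_le_rpow h1 hd.le
    nlinarith

lemma le_dimH_XS {S : Set ℕ} {d : NNReal} {c : ℝ} (hd : 0 < d) (hc : 0 ≤ c)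
    (h : ∀ N : ℕ, (d : ℝ) * N ≤ prefixCount S N + c) : (d : ENNReal) ≤ dimH (XS S) := by
  have hd' : (0 : ℝ) < d := hd
  choose! g hg1 hgS hgx using fun (x : ℝ) (hx : x ∈ XS S) => hx
  have hgx' : ∀ x ∈ XS S, compress univ (g x) = x := fun x hx => by
    rw [← tsum_eq_compress_univ (hg1 x hx), ← hgx x hx]
  have hH : HolderOnWith (2 ^ (1 + c + d) : ℝ).toNNReal d (fun x => compress S (g x)) (XS S) := by
    intro x hx y hy
    have key := abs_compress_sub_le_rpow hd' hc h (hg1 x hx) (hg1 y hy) (hgS x hx) (hgS y hy)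
    rw [hgx' x hx, hgx' y hy] at key
    rw [edist_dist, edist_dist, Real.dist_eq, Real.dist_eq,
      ENNReal.ofReal_rpow_of_nonneg (abs_nonneg _) hd'.le]
    change _ ≤ ENNReal.ofReal _ * _
    rw [← ENNReal.ofReal_mul (by positivity)]
    exact ENNReal.ofReal_le_ofReal key
  have hsub : Ico (0 : ℝ) 1 ⊆ (fun x => compress S (g x)) '' XS S := by
    intro y hy
    obtain ⟨ξ, hξ, hξS, rfl⟩ := exists_compress_eq (tendsto_prefixCount hd' h) hy
    have hx : compress univ ξ ∈ XS S := ⟨ξ, hξ, hξS, (tsum_eq_compress_univ hξ).symm⟩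
    refine ⟨compress univ ξ, hx, ?_⟩
    have key := abs_compress_sub_le_rpow hd' hc h (hg1 _ hx) hξ (hgS _ hx) hξS
    rw [hgx' _ hx, sub_self, abs_zero, Real.zero_rpow hd'.ne', mul_zero] at key
    exact sub_eq_zero.1 (abs_eq_zero.1 (le_antisymm key (abs_nonneg _)))
  have hI : dimH (Ico (0 : ℝ) 1) = 1 := by
    rw [Real.dimH_of_nonempty_interior (by simp)]
    simp
  have hle := (dimH_mono hsub).trans (hH.dimH_image_le hd)
  rw [hI, ENNReal.le_div_iff_mul_le (Or.inl (by exact_mod_cast hd.ne')) (Or.inl (by simp)),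
    one_mul] at hle
  exact hle

open scoped Classical in
/-- A finite set containing the length-`N` prefixes of all digit sequences supported on `S`. -/
noncomputable def prefixSet (S : Set ℕ) : ℕ → Finset ℕ
  | 0 => {0}
  | N + 1 => if N + 1 ∈ S
      then (prefixSet S N).image (2 * ·) ∪ (prefixSet S N).image (2 * · + 1)
      else (prefixSet S N).image (2 * ·)

lemma card_prefixSet_le (S : Set ℕ) (N : ℕ) : (prefixSet S N).card ≤ 2 ^ prefixCount S N := by
  induction N with
  | zero => simp [prefixSet, prefixCount_zero]
  | succ N ih =>
    by_cases h : N + 1 ∈ S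
    · rw [prefixCount_succ_of_mem h, pow_succ, mul_two]
      simp only [prefixSet, h, if_true]
      exact (Finset.card_union_le _ _).trans
        (add_le_add (Finset.card_image_le.trans ih) (Finset.card_image_le.trans ih))
    · rw [prefixCount_succ_of_notMem h]
      simp only [prefixSet, h, if_false]
      exact Finset.card_image_le.trans ih

lemma prefixVal_mem_prefixSet {S : Set ℕ} {ξ : ℕ → ℕ} (hξ : ∀ n, ξ n ≤ 1)
    (hξS : ∀ n, 1 ≤ n → n ∉ S → ξ n = 0) (N : ℕ) : prefixVal univ ξ N ∈ prefixSet S N := by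
  induction N with
  | zero => simp [prefixSet, prefixVal]
  | succ N ih =>
    rw [prefixVal_succ_of_mem ξ (mem_univ _)]
    by_cases h : N + 1 ∈ S
    · simp only [prefixSet, h, if_true, Finset.mem_union, Finset.mem_image]
      rcases Nat.le_one_iff_eq_zero_or_eq_one.1 (hξ (N + 1)) with h0 | h0
      · exact Or.inl ⟨_, ih, by rw [h0, add_zero]⟩
      · exact Or.inr ⟨_, ih, by rw [h0]⟩
    · simp only [prefixSet, h, if_false, Finset.mem_image]
      exact ⟨_, ih, by rw [hξS _ (by omega) h, add_zero]⟩

lemma dimH_XS_le {S : Set ℕ} {d : NNReal}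
    (h : ∃ᶠ N : ℕ in atTop, (prefixCount S N : ℝ) ≤ d * N) : dimH (XS S) ≤ d := by
  refine dimH_le_of_hausdorffMeasure_ne_top (ne_top_of_le_ne_top ENNReal.one_ne_top ?_)
  let t : (N : ℕ) → prefixSet S N → Set ℝ := fun N k =>
    Icc ((k : ℕ) / 2 ^ N : ℝ) (((k : ℕ) + 1) / 2 ^ N)
  have hdiam : ∀ N k, Metric.ediam (t N k) = ENNReal.ofReal ((1 / 2) ^ N) := by
    intro N k
    rw [Real.ediam_Icc]
    congr 1
    rw [one_div, inv_pow]
    ring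
  have hlim : Tendsto (fun N : ℕ => ENNReal.ofReal ((1 / 2) ^ N)) atTop (nhds 0) := by
    rw [← ENNReal.ofReal_zero]
    exact (ENNReal.continuous_ofReal.tendsto 0).comp
      (tendsto_pow_atTop_nhds_zero_of_lt_one (by norm_num) (by norm_num))
  have hcov : ∀ N, XS S ⊆ ⋃ k, t N k := by
    rintro N x ⟨ξ, hξ, hξS, rfl⟩
    rw [tsum_eq_compress_univ hξ]
    refine mem_iUnion.2 ⟨⟨_, prefixVal_mem_prefixSet hξ hξS N⟩, ?_⟩
    have h1 := prefixVal_div_le_compress univ hξ N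
    have h2 := compress_le_prefixVal_succ_div univ hξ N
    rw [prefixCount_univ] at h1 h2
    exact ⟨h1, h2⟩
  refine (MeasureTheory.Measure.hausdorffMeasure_le_liminf_sum (d : ℝ) (XS S) _ hlim t
    (Eventually.of_forall fun N k => (hdiam N k).le) (Eventually.of_forall hcov)).trans ?_
  refine liminf_le_of_frequently_le' (h.mono fun N hN => ?_)
  simp only [hdiam, Finset.sum_const, Finset.card_univ, Fintype.card_coe, nsmul_eq_mul]
  calc ((prefixSet S N).card : ENNReal) * ENNReal.ofReal ((1 / 2) ^ N) ^ (d : ℝ)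
      ≤ ENNReal.ofReal (2 ^ prefixCount S N) * ENNReal.ofReal ((1 / 2) ^ N) ^ (d : ℝ) := by
        gcongr
        rw [ENNReal.ofReal_pow two_pos.le, ENNReal.ofReal_ofNat]
        exact_mod_cast card_prefixSet_le S N
    _ = ENNReal.ofReal (2 ^ ((prefixCount S N : ℝ) - d * N)) := by
        rw [ENNReal.ofReal_rpow_of_nonneg (by positivity) d.coe_nonneg,
          ← ENNReal.ofReal_mul (by positivity), one_div, inv_pow,
          Real.inv_rpow (by positivity), Real.rpow_sub two_pos, Real.rpow_natCast, mul_comm (d : ℝ),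
          Real.rpow_mul two_pos.le, Real.rpow_natCast, div_eq_mul_inv]
    _ ≤ 1 := by
        rw [ENNReal.ofReal_le_one]
        exact Real.rpow_le_one_of_one_le_of_nonpos one_le_two (by linarith)

/-- The Hausdorff dimension of `X(S)` equals the lower density of `S`. -/
theorem dimH_XS_eq_lower_density (S : Set ℕ) (hS : ∀ n ∈ S, 1 ≤ n) :
    dimH (XS S) = ENNReal.ofReal
      (liminf (fun N : ℕ => (Nat.card ↥(S ∩ Set.Icc 1 N) : ℝ) / (N : ℝ)) atTop) := by
  simp only [card_inter_Icc]
  set u : ℕ → ℝ := fun N => (prefixCount S N : ℝ) / N with hu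
  have hbelow : IsBoundedUnder (· ≥ ·) atTop u :=
    isBoundedUnder_of ⟨0, fun N => by simp only [hu]; positivity⟩
  have habove : IsBoundedUnder (· ≤ ·) atTop u :=
    isBoundedUnder_of ⟨1, fun N => div_le_one_of_le₀
      (by exact_mod_cast prefixCount_le S N) (Nat.cast_nonneg N)⟩
  apply le_antisymm
  · by_contra! hlt
    obtain ⟨d, hd1, hd2⟩ := ENNReal.lt_iff_exists_nnreal_btwn.1 hlt
    have hd : liminf u atTop < d := (Real.le_coe_toNNReal _).trans_lt (ENNReal.coe_lt_coe.1 hd1)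
    have hfreq := frequently_lt_of_liminf_lt habove.isCoboundedUnder_ge hd
    refine hd2.not_ge (dimH_XS_le ?_)
    refine (hfreq.and_eventually (eventually_gt_atTop 0)).mono ?_
    rintro N ⟨h1, h2⟩
    exact ((div_lt_iff₀ (by exact_mod_cast h2)).1 h1).le
  · by_contra! hlt
    obtain ⟨d, hd1, hd2⟩ := ENNReal.lt_iff_exists_nnreal_btwn.1 hlt
    have hdpos : 0 < d := by exact_mod_cast (zero_le.trans_lt hd1)
    have hd : (d : ℝ) < liminf u atTop := ENNReal.coe_lt_ofReal.1 hd2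
    obtain ⟨N₀, hN₀⟩ := eventually_atTop.1 (eventually_lt_of_lt_liminf hd hbelow)
    refine hd1.not_ge (le_dimH_XS (c := d * N₀) hdpos (by positivity) fun N => ?_)
    rcases Nat.eq_zero_or_pos N with rfl | hN
    · simp only [Nat.cast_zero, mul_zero]
      positivity
    rcases le_total N₀ N with hle | hle
    · have := (lt_div_iff₀ (by exact_mod_cast hN)).1 (hN₀ N hle)
      have h0 : (0 : ℝ) ≤ d * N₀ := by positivity
      linarith
    · have h1 : (d : ℝ) * N ≤ d * N₀ := by gcongr
      have h2 : (0 : ℝ) ≤ prefixCount S N := by positivity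
      linarith
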